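/- For $0<p\le 1/2$, the power series $\sum_{k\ge 0} x^k \widehat{F}_k(g_p)$ with $\widehat{F}_k(g_p)=\big(\frac{p}{3(1-p)^2}\big)^k \frac{(3k-2)!}{k!(2k-1)!}\big(\frac{3k(1-p)}{p}+2-3k\big)$ for $k\ge 1$ and $\widehat F_0=1$ has radius of convergence $\widehat r_p = \frac{4(1-p)^2}{9p}$. Moreover $z_p F^2(g_p,z_p) = \frac{(1-4p)^2\cdot(\text{sic})}{9(1-p)}$, more precisely $z_p F(g_p,z_p)^2 = \frac{(3-4p)^2}{9(1-p)}$, and this quantity is strictly less than $\widehat r_p$ for $p<1/2$, with equality at $p=1/2$. -/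

import Mathlib

open Filter Topology in
theorem tendsto_affine_succ_div {A : ℝ} (hA : 0 ≤ A) :
    Tendsto (fun k : ℕ => (A * (k + 1) + 2) / (A * k + 2)) atTop (𝓝 1) := by
  have h : Tendsto (fun k : ℕ => A / (A * k + 2)) atTop (𝓝 0) := by
    refine tendsto_of_tendsto_of_tendsto_of_le_of_le' tendsto_const_nhds
      (tendsto_const_div_atTop_nhds_zero_nat 1) ?_ ?_
    · exact Eventually.of_forall fun k => by positivity
    · filter_upwards [eventually_ge_atTop 1] with k hk
      have hk' : (0 : ℝ) < k := by exact_mod_cast hk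
      rw [div_le_div_iff₀ (by positivity) hk']
      linarith
  have h' := h.const_add 1
  rw [add_zero] at h'
  refine h'.congr fun k => ?_
  have : A * k + 2 ≠ 0 := by positivity
  field_simp
  ring

theorem factorial_quotient_succ {k : ℕ} (hk : 1 ≤ k) :
    ((3 * (k + 1) - 2).factorial : ℝ) / ((k + 1).factorial * (2 * (k + 1) - 1).factorial)
      = 3 / 2 * ((1 + 3 * k) / (1 + 1 * k)) * ((-1 + 3 * k) / (1 + 2 * k))
        * ((3 * k - 2).factorial / (k.factorial * (2 * k - 1).factorial)) := by
  obtain ⟨m, rfl⟩ := Nat.exists_eq_add_of_le' hk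
  have h₁ : 3 * (m + 1 + 1) - 2 = 3 * m + 1 + 1 + 1 + 1 := by omega
  have h₂ : 3 * (m + 1) - 2 = 3 * m + 1 := by omega
  have h₃ : 2 * (m + 1 + 1) - 1 = 2 * m + 1 + 1 + 1 := by omega
  have h₄ : 2 * (m + 1) - 1 = 2 * m + 1 := by omega
  rw [h₁, h₂, h₃, h₄]
  simp only [Nat.factorial_succ (3 * m + 1 + 1 + 1), Nat.factorial_succ (3 * m + 1 + 1),
    Nat.factorial_succ (3 * m + 1), Nat.factorial_succ (2 * m + 1 + 1),
    Nat.factorial_succ (2 * m + 1), Nat.factorial_succ (m + 1)]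
  have := (3 * m + 1).factorial_pos
  have := (2 * m + 1).factorial_pos
  have := (m + 1).factorial_pos
  push_cast
  field_simp
  ring

open Filter Topology in
theorem tendsto_ratio_of_factorial_quotient {c A : ℝ} (hc : 0 < c) (hA : 0 ≤ A) {x : ℝ}
    (hx : x ≠ 0) {f : ℕ → ℝ}
    (hf : ∀ k : ℕ, 1 ≤ k → f k = c ^ k * ((3 * k - 2).factorial : ℝ)
      / ((k.factorial : ℝ) * ((2 * k - 1).factorial : ℝ)) * (A * k + 2)) :
    Tendsto (fun k => ‖f (k + 1) * x ^ (k + 1)‖ / ‖f k * x ^ k‖) atTop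
      (𝓝 (27 / 4 * c * |x|)) := by
  have h := ((((tendsto_add_mul_div_add_mul_atTop_nhds (1 : ℝ) 1 3 one_ne_zero).const_mul
    (3 / 2)).mul (tendsto_add_mul_div_add_mul_atTop_nhds (-1 : ℝ) 1 3 two_ne_zero)).mul
    (tendsto_affine_succ_div hA)).mul_const (c * |x|)
  have hlim : 3 / 2 * (3 / 1) * (3 / 2) * 1 * (c * |x|) = 27 / 4 * c * |x| := by ring
  rw [hlim] at h
  refine h.congr' ?_
  filter_upwards [eventually_ge_atTop 1] with k hk
  have hpos : ∀ j, 1 ≤ j → 0 < f j := fun j hj => by rw [hf j hj]; positivity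
  rw [norm_mul, norm_mul, norm_pow, norm_pow, Real.norm_of_nonneg (hpos k hk).le,
    Real.norm_of_nonneg (hpos (k + 1) (by omega)).le, Real.norm_eq_abs, hf k hk,
    hf (k + 1) (by omega), mul_div_assoc (c ^ (k + 1)), factorial_quotient_succ hk]
  have hx' : 0 < |x| := abs_pos.mpr hx
  have : A * k + 2 ≠ 0 := by positivity
  push_cast
  field_simp
  ring

/-- For `0 < p ≤ 1/2`, the power series `∑_k F̂_k(g_p) x^k`, where
`F̂_k(g_p) = (p/(3(1-p)²))^k (3k-2)!/(k!(2k-1)!) (3k(1-p)/p + 2 - 3k)` for `k ≥ 1` and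
`F̂_0 = 1`, has radius of convergence `r̂_p = 4(1-p)²/(9p)`. Moreover
`z_p F(g_p,z_p)² = (3-4p)²/(9(1-p))`, which is strictly smaller than `r̂_p` for
`p < 1/2` and equal to it at `p = 1/2`. -/
theorem simple_boundary_series_radius (p : ℝ) (hp0 : 0 < p) (hp : p ≤ 1/2)
    (Fhat : ℕ → ℝ)
    (hFhat0 : Fhat 0 = 1)
    (hFhat : ∀ σ : ℕ, 1 ≤ σ →
      Fhat σ = (p / (3 * (1 - p) ^ 2)) ^ σ
        * ((3 * σ - 2).factorial : ℝ) / ((σ.factorial : ℝ) * ((2 * σ - 1).factorial : ℝ))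
        * (3 * (σ : ℝ) * (1 - p) / p + 2 - 3 * (σ : ℝ))) :
    (∀ x : ℝ, |x| < 4 * (1 - p) ^ 2 / (9 * p) →
        Summable (fun k : ℕ => Fhat k * x ^ k)) ∧
    (∀ x : ℝ, 4 * (1 - p) ^ 2 / (9 * p) < |x| →
        ¬ Summable (fun k : ℕ => Fhat k * x ^ k)) ∧
    ((1 - p) / 4) * ((2 / 3) * (3 - 4 * p) / (1 - p)) ^ 2 = (3 - 4 * p) ^ 2 / (9 * (1 - p)) ∧
    (p < 1/2 → (3 - 4 * p) ^ 2 / (9 * (1 - p)) < 4 * (1 - p) ^ 2 / (9 * p)) ∧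
    (p = 1/2 → (3 - 4 * p) ^ 2 / (9 * (1 - p)) = 4 * (1 - p) ^ 2 / (9 * p)) := by
  have hq : 0 < 1 - p := by linarith
  have hA : 0 ≤ 3 * (1 - 2 * p) / p := div_nonneg (by linarith) hp0.le
  have hc : 0 < p / (3 * (1 - p) ^ 2) := by positivity
  have hf : ∀ k : ℕ, 1 ≤ k → Fhat k = (p / (3 * (1 - p) ^ 2)) ^ k * ((3 * k - 2).factorial : ℝ)
      / ((k.factorial : ℝ) * ((2 * k - 1).factorial : ℝ)) * (3 * (1 - 2 * p) / p * k + 2) := by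
    intro k hk
    rw [hFhat k hk]
    congr 1
    field_simp
    ring
  have hr : 4 * (1 - p) ^ 2 / (9 * p) = (27 / 4 * (p / (3 * (1 - p) ^ 2)))⁻¹ := by
    field_simp
    norm_num
  have hC : 0 < 27 / 4 * (p / (3 * (1 - p) ^ 2)) := by positivity
  refine ⟨fun x hx => ?_, fun x hx => ?_, ?_, fun hlt => ?_, ?_⟩
  · rcases eq_or_ne x 0 with rfl | hx0
    · refine summable_of_ne_finset_zero (s := {0}) fun k hk => ?_
      rw [zero_pow (by simpa using hk), mul_zero]
    · refine summable_of_ratio_test_tendsto_lt_one ?_ ?_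
        (tendsto_ratio_of_factorial_quotient hc hA hx0 hf)
      · rwa [hr, lt_inv_comm₀ (abs_pos.mpr hx0) hC, ← one_div, lt_div_iff₀
          (abs_pos.mpr hx0)] at hx
      · filter_upwards [Filter.eventually_ge_atTop 1] with k hk
        have : 0 < Fhat k := by rw [hf k hk]; positivity
        exact mul_ne_zero this.ne' (pow_ne_zero k hx0)
  · have hx0 : 0 < |x| := lt_of_le_of_lt (by positivity) hx
    refine not_summable_of_ratio_test_tendsto_gt_one ?_
      (tendsto_ratio_of_factorial_quotient hc hA (abs_pos.mp hx0) hf)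
    rwa [hr, inv_lt_comm₀ hC hx0, ← one_div, div_lt_iff₀ hx0] at hx
  · field_simp
    ring
  · rw [div_lt_div_iff₀ (by positivity) (by positivity)]
    have : 0 < (1 - 2 * p) ^ 2 * (4 - 5 * p) :=
      mul_pos (pow_pos (by linarith) 2) (by linarith)
    linarith
  · rintro rfl
    norm_num
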